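/- arXiv:2012.15364 — 3 statements merged into one kernel-verified Lean document; each statement's English description precedes it below -/
import Mathlib

section
/- Let D be an unbounded self-adjoint operator on a complex Hilbert space H with domain dom(D), and let p be an orthogonal projection on H such that p·dom(D) ⊆ dom(D) and the commutator [D, p] is bounded on dom(D). Then the unbounded operator D_p := pDp with domain dom(D_p) := p·dom(D), regarded as an operator on the Hilbert space p(H), is self-adjoint. -/
/-- Let `T` be an unbounded self-adjoint operator on a complex Hilbert space `H`,
and let `p` be an orthogonal projection on `H` with `p · dom T ⊆ dom T` and `[T, p]` bounded on
`dom T`. Then the operator `Dp = p T p` with domain `p · dom T`, regarded as an operator on the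
Hilbert space `p(H)` (realised as the submodule `K` with underlying set `range p`), is
self-adjoint. -/
theorem statement1 {H : Type*} [NormedAddCommGroup H] [InnerProductSpace ℂ H] [CompleteSpace H]
    (T : H →ₗ.[ℂ] H) (hsaT : IsSelfAdjoint T)
    (p : H →L[ℂ] H) (hp_sa : IsSelfAdjoint p) (hp_idem : IsIdempotentElem p)
    (hp_dom : ∀ ξ ∈ T.domain, p ξ ∈ T.domain)
    (hp_comm : ∃ C : ℝ, ∀ (ξ : T.domain) (h : p ↑ξ ∈ T.domain),
      ‖T ⟨p ↑ξ, h⟩ - p (T ξ)‖ ≤ C * ‖(ξ : H)‖)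
    (K : Submodule ℂ H) [CompleteSpace K] (hK : (K : Set H) = Set.range p)
    (Dp : K →ₗ.[ℂ] K)
    (hDp_dom : ∀ ξ : K, ξ ∈ Dp.domain ↔ ∃ η ∈ T.domain, p η = (ξ : H))
    (hDp : ∀ (ξ : Dp.domain) (h : ((ξ : K) : H) ∈ T.domain),
      ((Dp ξ : K) : H) = p (T ⟨((ξ : K) : H), h⟩)) :
    IsSelfAdjoint Dp := by
  obtain ⟨C, hC⟩ := hp_comm
  have hpK : ∀ x, p x ∈ K := fun x => by
    rw [← SetLike.mem_coe, hK]
    exact Set.mem_range_self x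
  have hp_fix : ∀ x : K, p (x : H) = x := fun x => by
    obtain ⟨z, hz⟩ : (x : H) ∈ Set.range p := hK ▸ x.2
    rw [← hz]
    exact congrArg (fun f : H →L[ℂ] H => f z) hp_idem
  have hp_inner : ∀ x y : H, inner ℂ (p x) y = inner ℂ x (p y) := hp_sa.isSymmetric
  have hT_dense := hsaT.dense_domain
  have hT_symm : ∀ x y : T.domain, inner ℂ (T x) (y : H) = inner ℂ (x : H) (T y) := by
    have h := LinearPMap.adjoint_isFormalAdjoint hT_dense
    rwa [LinearPMap.isSelfAdjoint_def.mp hsaT] at h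
  have h_dom : ∀ x : Dp.domain, ((x : K) : H) ∈ T.domain := fun x => by
    obtain ⟨η, hη, h⟩ := (hDp_dom x).mp x.2
    exact h ▸ hp_dom η hη
  have h_dense : Dense (Dp.domain : Set K) := fun x => by
    have h := map_mem_closure (p.codRestrict K hpK).continuous (hT_dense (x : H))
      (t := (Dp.domain : Set K)) fun η hη => (hDp_dom _).mpr ⟨η, hη, rfl⟩
    have hx : p.codRestrict K hpK (x : H) = x := Subtype.ext (hp_fix x)
    rwa [hx] at h
  have h_formal : Dp.IsFormalAdjoint Dp := fun x y => by
    rw [Submodule.coe_inner, Submodule.coe_inner, hDp x (h_dom x), hDp y (h_dom y), hp_inner,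
      hp_fix, ← hp_inner, hp_fix]
    exact hT_symm ⟨_, h_dom x⟩ ⟨_, h_dom y⟩
  have h_le := h_formal.le_adjoint h_dense
  rw [LinearPMap.isSelfAdjoint_def]
  refine (LinearPMap.eq_of_le_of_domain_eq h_le (le_antisymm h_le.1 fun y hy => ?_)).symm
  refine (hDp_dom y).mpr ⟨y, ?_, hp_fix y⟩
  rw [← LinearPMap.isSelfAdjoint_def.mp hsaT, LinearPMap.mem_adjoint_domain_iff]
  set w : K := Dp.adjoint ⟨y, hy⟩
  have h_pair : ∀ ξ : T.domain,
      inner ℂ (y : H) (T ⟨p ξ, hp_dom ξ ξ.2⟩) = inner ℂ (w : H) (ξ : H) := fun ξ => by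
    have h := LinearPMap.adjoint_isFormalAdjoint h_dense ⟨y, hy⟩
      ⟨⟨p ξ, hpK ξ⟩, (hDp_dom _).mpr ⟨ξ, ξ.2, rfl⟩⟩
    rw [Submodule.coe_inner, Submodule.coe_inner, hDp _ (hp_dom ξ ξ.2), ← hp_inner, ← hp_inner,
      hp_fix, hp_fix] at h
    exact h.symm
  refine AddMonoidHomClass.continuous_of_bound _ (‖(w : H)‖ + ‖(y : H)‖ * C) fun ξ => ?_
  have h_split : inner ℂ (y : H) (T ξ) = inner ℂ (w : H) (ξ : H)
      - inner ℂ (y : H) (T ⟨p ξ, hp_dom ξ ξ.2⟩ - p (T ξ)) := by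
    rw [inner_sub_right, h_pair, ← hp_inner, hp_fix, sub_sub_cancel]
  change ‖inner ℂ (y : H) (T ξ)‖ ≤ _ * ‖(ξ : H)‖
  calc ‖inner ℂ (y : H) (T ξ)‖
      ≤ ‖(w : H)‖ * ‖(ξ : H)‖ + ‖(y : H)‖ * ‖T ⟨p ξ, hp_dom ξ ξ.2⟩ - p (T ξ)‖ := by
        rw [h_split]
        exact (norm_sub_le _ _).trans (add_le_add (norm_inner_le_norm _ _) (norm_inner_le_norm _ _))
    _ ≤ ‖(w : H)‖ * ‖(ξ : H)‖ + ‖(y : H)‖ * (C * ‖(ξ : H)‖) := by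
        gcongr
        exact hC ξ _
    _ = (‖(w : H)‖ + ‖(y : H)‖ * C) * ‖(ξ : H)‖ := by ring
end

section
/- Let D be an unbounded self-adjoint operator on a complex Hilbert space H with domain dom(D), and let p be an orthogonal projection on H such that p·dom(D) ⊆ dom(D) and the commutator [D, p] is bounded on dom(D). If D has compact resolvent, then the self-adjoint operator D_p := pDp with domain p·dom(D) on the Hilbert space p(H) has compact resolvent. -/
/-- `R` is the (bounded, two-sided) inverse of `lam • 1 - T`, i.e. `lam` lies in the resolvent
set of the unbounded operator `T` and `R = (lam • 1 - T)⁻¹`. -/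
def IsResolventAt {H : Type*} [NormedAddCommGroup H] [InnerProductSpace ℂ H]
    (T : H →ₗ.[ℂ] H) (lam : ℂ) (R : H →L[ℂ] H) : Prop :=
  (∀ ξ : T.domain, R (lam • (ξ : H) - T ξ) = ξ) ∧
    ∀ η : H, ∃ h : R η ∈ T.domain, lam • (R η) - T ⟨R η, h⟩ = η

/-- The unbounded operator `T` has compact resolvent: some `lam` lies in its resolvent set and
the corresponding resolvent operator is compact. -/
def HasCompactResolvent {H : Type*} [NormedAddCommGroup H] [InnerProductSpace ℂ H]
    (T : H →ₗ.[ℂ] H) : Prop :=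
  ∃ (lam : ℂ) (R : H →L[ℂ] H), IsResolventAt T lam R ∧ IsCompactOperator ⇑R

namespace LinearPMap

variable {E : Type*} [NormedAddCommGroup E] [InnerProductSpace ℂ E] [CompleteSpace E]

theorem inner_apply_comm_of_isSelfAdjoint {A : E →ₗ.[ℂ] E} (hA : IsSelfAdjoint A)
    (x y : A.domain) : inner ℂ (A x) (y : E) = inner ℂ (x : E) (A y) := by
  have h := adjoint_isFormalAdjoint hA.dense_domain
  rw [isSelfAdjoint_def.mp hA] at h
  exact h x y

theorem im_inner_apply_self {A : E →ₗ.[ℂ] E} (hA : IsSelfAdjoint A) (x : A.domain) :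
    (inner ℂ (x : E) (A x)).im = 0 := by
  rw [← Complex.conj_eq_iff_im, inner_conj_symm, inner_apply_comm_of_isSelfAdjoint hA]

theorem norm_I_smul_sub_sq {A : E →ₗ.[ℂ] E} (hA : IsSelfAdjoint A) (x : A.domain) :
    ‖Complex.I • (x : E) - A x‖ ^ 2 = ‖(x : E)‖ ^ 2 + ‖A x‖ ^ 2 := by
  rw [@norm_sub_sq ℂ, inner_smul_left, norm_smul]
  simp [im_inner_apply_self hA x]

theorem eq_zero_of_inner_I_smul_sub_eq_zero {A : E →ₗ.[ℂ] E} (hA : IsSelfAdjoint A) {z : E}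
    (hz : ∀ x : A.domain, inner ℂ z (Complex.I • (x : E) - A x) = 0) : z = 0 := by
  have hadj := isSelfAdjoint_def.mp hA
  have key : ∀ x : A.domain, inner ℂ (-Complex.I • z) (x : E) = inner ℂ z (A x) := by
    intro x
    have h := hz x
    rw [inner_sub_right, inner_smul_right, sub_eq_zero] at h
    rw [← h, inner_smul_left]
    simp
  have hmem : z ∈ A.domain := by
    have h := mem_adjoint_domain_of_exists (T := A) z ⟨_, key⟩
    rwa [hadj] at h
  have him := im_inner_apply_self hA ⟨z, hmem⟩
  rw [← key ⟨z, hmem⟩, inner_smul_left] at him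
  rw [show (starRingEnd ℂ) (-Complex.I) = Complex.I by simp, Complex.I_mul_im] at him
  exact (re_inner_self_nonpos (𝕜 := ℂ)).mp him.le

theorem exists_isResolventAt_I {A : E →ₗ.[ℂ] E} (hA : IsSelfAdjoint A) :
    ∃ R : E →L[ℂ] E, IsResolventAt A Complex.I R := by
  have : CompleteSpace A.graph := hA.isClosed.completeSpace_coe
  let f : A.graph →L[ℂ] E :=
    (Complex.I • ContinuousLinearMap.fst ℂ E E - ContinuousLinearMap.snd ℂ E E).comp
      A.graph.subtypeL
  have hf_mk : ∀ x : A.domain, f ⟨((x : E), A x), A.mem_graph x⟩ = Complex.I • (x : E) - A x :=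
    fun _ => rfl
  have hlip : AntilipschitzWith 1 f := by
    refine AddMonoidHomClass.antilipschitz_of_bound f fun g => ?_
    obtain ⟨⟨x, y⟩, hg⟩ := g
    obtain ⟨x, rfl, rfl⟩ := (mem_graph_iff A).mp hg
    have h := norm_I_smul_sub_sq hA x
    rw [NNReal.coe_one, one_mul]
    change max ‖(x : E)‖ ‖A x‖ ≤ ‖Complex.I • (x : E) - A x‖
    exact max_le (abs_le_of_sq_le_sq' (by nlinarith [sq_nonneg ‖A x‖]) (norm_nonneg _) |>.2)
      (abs_le_of_sq_le_sq' (by nlinarith [sq_nonneg ‖(x : E)‖]) (norm_nonneg _) |>.2)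
  have hclosed : _root_.IsClosed (f.range : Set E) := by
    rw [LinearMap.coe_range]
    exact hlip.isClosed_range f.uniformContinuous
  have hrange : f.range = ⊤ := by
    have : CompleteSpace f.range := hclosed.completeSpace_coe
    rw [← Submodule.orthogonal_eq_bot_iff, Submodule.eq_bot_iff]
    intro z hz
    refine eq_zero_of_inner_I_smul_sub_eq_zero hA fun x => ?_
    rw [← hf_mk]
    exact (Submodule.mem_orthogonal' _ _).mp hz _ ⟨_, rfl⟩
  have hker : f.ker = ⊥ := LinearMap.ker_eq_bot.mpr hlip.injective
  let e := ContinuousLinearEquiv.ofBijective f hker hrange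
  refine ⟨((ContinuousLinearMap.fst ℂ E E).comp A.graph.subtypeL).comp
    (e.symm : E →L[ℂ] A.graph), fun x => ?_, fun η => ?_⟩
  · have h : e.symm (Complex.I • (x : E) - A x) = ⟨((x : E), A x), A.mem_graph x⟩ := by
      rw [ContinuousLinearEquiv.symm_apply_eq]
      rfl
    exact congrArg (fun g : A.graph => (g : E × E).1) h
  · obtain ⟨x, hx₁, hx₂⟩ := (mem_graph_iff A).mp (e.symm η).2
    have h : e (e.symm η) = η := e.apply_symm_apply η
    have hη : Complex.I • ((e.symm η : A.graph) : E × E).1 - ((e.symm η : A.graph) : E × E).2 = η :=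
      h
    refine ⟨show ((e.symm η : A.graph) : E × E).1 ∈ A.domain from hx₁ ▸ x.2, ?_⟩
    change Complex.I • ((e.symm η : A.graph) : E × E).1 - A ⟨((e.symm η : A.graph) : E × E).1, _⟩ = η
    have hx : x = ⟨((e.symm η : A.graph) : E × E).1, hx₁ ▸ x.2⟩ := Subtype.ext hx₁
    rw [← hx, hx₂, hη]

end LinearPMap

section Compression

variable {H : Type*} [NormedAddCommGroup H] [InnerProductSpace ℂ H]
  {T : H →ₗ.[ℂ] H} {p : H →L[ℂ] H} {K : Submodule ℂ H} {Dp : K →ₗ.[ℂ] K}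

/-- The compression of a self-adjoint operator by a projection with which it has bounded
commutator is self-adjoint. -/
theorem isSelfAdjoint_compression [CompleteSpace H] [CompleteSpace K]
    (hsaT : IsSelfAdjoint T)
    (hp_sa : IsSelfAdjoint p) (hpK : ∀ ξ, p ξ ∈ K) (hp_id : ∀ ξ ∈ K, p ξ = ξ)
    (hp_dom : ∀ ξ ∈ T.domain, p ξ ∈ T.domain)
    (hp_comm : ∃ C : ℝ, ∀ (ξ : T.domain) (h : p ↑ξ ∈ T.domain),
      ‖T ⟨p ↑ξ, h⟩ - p (T ξ)‖ ≤ C * ‖(ξ : H)‖)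
    (hdom : ∀ ξ : K, ξ ∈ Dp.domain ↔ (ξ : H) ∈ T.domain)
    (hDp : ∀ (ξ : Dp.domain) (h : ((ξ : K) : H) ∈ T.domain),
      ((Dp ξ : K) : H) = p (T ⟨((ξ : K) : H), h⟩)) :
    IsSelfAdjoint Dp := by
  have hp_inner : ∀ x y : H, inner ℂ (p x) y = inner ℂ x (p y) := hp_sa.isSymmetric
  have hdense : Dense (Dp.domain : Set K) := by
    let q : H → K := fun ξ => ⟨p ξ, hpK ξ⟩
    have hq : Continuous q := p.continuous.subtype_mk _
    have hq_surj : Function.Surjective q := fun ξ => ⟨ξ, Subtype.ext (hp_id ξ ξ.2)⟩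
    refine (hq_surj.denseRange.dense_image hq hsaT.dense_domain).mono ?_
    rintro _ ⟨ξ, hξ, rfl⟩
    exact (hdom _).mpr (hp_dom ξ hξ)
  have hformal : Dp.IsFormalAdjoint Dp := by
    intro x y
    have hx := (hdom x).mp x.2
    have hy := (hdom y).mp y.2
    rw [Submodule.coe_inner, Submodule.coe_inner, hDp x hx, hDp y hy, hp_inner, hp_id _ (y : K).2,
      ← hp_inner (x : K), hp_id _ (x : K).2]
    exact LinearPMap.inner_apply_comm_of_isSelfAdjoint hsaT ⟨_, hx⟩ ⟨_, hy⟩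
  have hle : Dp ≤ Dp.adjoint := hformal.le_adjoint hdense
  refine (LinearPMap.eq_of_le_of_domain_eq hle (le_antisymm hle.1 fun y hy => ?_)).symm
  rw [hdom, ← LinearPMap.isSelfAdjoint_def.mp hsaT, LinearPMap.mem_adjoint_domain_iff]
  obtain ⟨C, hC⟩ := hp_comm
  let w : K := Dp.adjoint ⟨y, hy⟩
  refine AddMonoidHomClass.continuous_of_bound _ (‖w‖ * ‖p‖ + ‖y‖ * C) fun x => ?_
  have hx := hp_dom x x.2
  have hw := LinearPMap.adjoint_isFormalAdjoint hdense ⟨y, hy⟩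
    ⟨⟨p x, hpK x⟩, (hdom _).mpr hx⟩
  rw [Submodule.coe_inner, Submodule.coe_inner, hDp _ hx, ← hp_inner (y : H), hp_id _ y.2] at hw
  have hsplit : inner ℂ (y : H) (T x) =
      inner ℂ (w : H) (p x) - inner ℂ (y : H) (T ⟨p x, hx⟩ - p (T x)) := by
    rw [inner_sub_right, ← hp_inner (y : H), hp_id _ y.2]
    rw [show inner ℂ (w : H) (p x) = inner ℂ (y : H) (T ⟨p x, hx⟩) from hw]
    ring
  change ‖inner ℂ (y : H) (T x)‖ ≤ _ * ‖(x : H)‖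
  rw [hsplit]
  calc _ ≤ ‖(w : H)‖ * ‖p x‖ + ‖(y : H)‖ * ‖T ⟨p x, hx⟩ - p (T x)‖ :=
        (norm_sub_le _ _).trans (by gcongr <;> exact norm_inner_le_norm _ _)
    _ ≤ ‖(w : H)‖ * (‖p‖ * ‖(x : H)‖) + ‖(y : H)‖ * (C * ‖(x : H)‖) := by
        gcongr
        · exact p.le_opNorm _
        · exact hC x hx
    _ = (‖w‖ * ‖p‖ + ‖y‖ * C) * ‖(x : H)‖ := by
        rw [Submodule.coe_norm, Submodule.coe_norm]
        ring

/-- A resolvent of the compression factors through any resolvent of the full operator. -/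
theorem IsResolventAt.exists_factorization {lam mu : ℂ} {R₀ : H →L[ℂ] H} {R : K →L[ℂ] K}
    (hR₀ : IsResolventAt T lam R₀) (hR : IsResolventAt Dp mu R)
    (hp_id : ∀ ξ ∈ K, p ξ = ξ)
    (hp_comm : ∃ C : ℝ, ∀ (ξ : T.domain) (h : p ↑ξ ∈ T.domain),
      ‖T ⟨p ↑ξ, h⟩ - p (T ξ)‖ ≤ C * ‖(ξ : H)‖)
    (hdom : ∀ ξ : K, ξ ∈ Dp.domain ↔ (ξ : H) ∈ T.domain)
    (hDp : ∀ (ξ : Dp.domain) (h : ((ξ : K) : H) ∈ T.domain),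
      ((Dp ξ : K) : H) = p (T ⟨((ξ : K) : H), h⟩)) :
    ∃ S : K →L[ℂ] H, ∀ η, ((R η : K) : H) = R₀ (S η) := by
  obtain ⟨C, hC⟩ := hp_comm
  have hRdom : ∀ η, ((R η : K) : H) ∈ T.domain := fun η => (hdom _).mp (hR.2 η).1
  let V : K →ₗ[ℂ] T.domain := (K.subtype ∘ₗ R.toLinearMap).codRestrict T.domain hRdom
  have hbound : ∀ η, ‖T (V η)‖ ≤ ((‖mu‖ + |C|) * ‖R‖ + 1) * ‖η‖ := by
    intro η
    have hx : R η ∈ Dp.domain := (hR.2 η).1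
    have hη : mu • R η - Dp ⟨R η, hx⟩ = η := (hR.2 η).2
    have hpR : p (R η : H) = R η := hp_id _ (R η).2
    have hpRdom : p (R η : H) ∈ T.domain := by
      rw [hpR]
      exact hRdom η
    have hpV : (⟨p (V η : H), hpRdom⟩ : T.domain) = V η := Subtype.ext hpR
    have hcomm := hC (V η) hpRdom
    rw [hpV, show p (T (V η)) = Dp ⟨R η, hx⟩ from (hDp ⟨R η, hx⟩ (hRdom η)).symm] at hcomm
    have hDpR : ‖((Dp ⟨R η, hx⟩ : K) : H)‖ ≤ ‖mu‖ * ‖R η‖ + ‖η‖ := by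
      rw [← Submodule.coe_norm, ← norm_smul]
      nth_rw 1 [show Dp ⟨R η, hx⟩ = mu • R η - η by
        rw [eq_sub_iff_add_eq, ← eq_sub_iff_add_eq', hη]]
      exact norm_sub_le _ _
    calc ‖T (V η)‖ ≤ ‖T (V η) - Dp ⟨R η, hx⟩‖ + ‖((Dp ⟨R η, hx⟩ : K) : H)‖ :=
          norm_le_norm_sub_add _ _
      _ ≤ |C| * ‖R η‖ + (‖mu‖ * ‖R η‖ + ‖η‖) :=
          add_le_add (hcomm.trans (mul_le_mul_of_nonneg_right (le_abs_self C) (norm_nonneg _))) hDpR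
      _ = (‖mu‖ + |C|) * ‖R η‖ + ‖η‖ := by ring
      _ ≤ (‖mu‖ + |C|) * (‖R‖ * ‖η‖) + ‖η‖ := by
          gcongr
          exact R.le_opNorm η
      _ = ((‖mu‖ + |C|) * ‖R‖ + 1) * ‖η‖ := by ring
  let TR : K →L[ℂ] H := (T.toFun ∘ₗ V).mkContinuous _ hbound
  refine ⟨lam • K.subtypeL.comp R - TR, fun η => ?_⟩
  exact (hR₀.1 (V η)).symm

end Compression

/-- Let `T` be an unbounded self-adjoint operator on a complex Hilbert space `H`,
and let `p` be an orthogonal projection on `H` with `p · dom T ⊆ dom T` and `[T, p]` bounded on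
`dom T`. If `T` has compact resolvent, then the self-adjoint operator `Dp = p T p` with domain
`p · dom T` on the Hilbert space `p(H)` has compact resolvent. -/
theorem statement2 {H : Type*} [NormedAddCommGroup H] [InnerProductSpace ℂ H] [CompleteSpace H]
    (T : H →ₗ.[ℂ] H) (hsaT : IsSelfAdjoint T)
    (p : H →L[ℂ] H) (hp_sa : IsSelfAdjoint p) (hp_idem : IsIdempotentElem p)
    (hp_dom : ∀ ξ ∈ T.domain, p ξ ∈ T.domain)
    (hp_comm : ∃ C : ℝ, ∀ (ξ : T.domain) (h : p ↑ξ ∈ T.domain),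
      ‖T ⟨p ↑ξ, h⟩ - p (T ξ)‖ ≤ C * ‖(ξ : H)‖)
    (hcr : HasCompactResolvent T)
    (K : Submodule ℂ H) [CompleteSpace K] (hK : (K : Set H) = Set.range p)
    (Dp : K →ₗ.[ℂ] K)
    (hDp_dom : ∀ ξ : K, ξ ∈ Dp.domain ↔ ∃ η ∈ T.domain, p η = (ξ : H))
    (hDp : ∀ (ξ : Dp.domain) (h : ((ξ : K) : H) ∈ T.domain),
      ((Dp ξ : K) : H) = p (T ⟨((ξ : K) : H), h⟩)) :
    HasCompactResolvent Dp := by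
  have hpK : ∀ ξ, p ξ ∈ K := fun ξ => by
    rw [← SetLike.mem_coe, hK]
    exact ⟨ξ, rfl⟩
  have hp_id : ∀ ξ ∈ K, p ξ = ξ := by
    intro ξ hξ
    rw [← SetLike.mem_coe, hK] at hξ
    obtain ⟨η, rfl⟩ := hξ
    exact congrArg (fun q : H →L[ℂ] H => q η) hp_idem.eq
  have hdom : ∀ ξ : K, ξ ∈ Dp.domain ↔ (ξ : H) ∈ T.domain := by
    intro ξ
    rw [hDp_dom]
    exact ⟨fun ⟨η, hη, h⟩ => h ▸ hp_dom η hη, fun h => ⟨ξ, h, hp_id ξ ξ.2⟩⟩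
  obtain ⟨lam, R₀, hR₀, hcompact⟩ := hcr
  obtain ⟨R, hR⟩ := LinearPMap.exists_isResolventAt_I
    (isSelfAdjoint_compression hsaT hp_sa hpK hp_id hp_dom hp_comm hdom hDp)
  obtain ⟨S, hS⟩ := hR₀.exists_factorization hR hp_id hp_comm hdom hDp
  have hclosed : IsClosed (K : Set H) := (completeSpace_coe_iff_isComplete.mp ‹_›).isClosed
  refine ⟨Complex.I, R, hR, ?_⟩
  have hSK : ∀ η, (R₀ ∘ S) η ∈ K := fun η => by
    rw [Function.comp_apply, ← hS η]
    exact (R η).2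
  have hR_eq : ⇑R = Set.codRestrict (R₀ ∘ S) K hSK := funext fun η => Subtype.ext (hS η)
  rw [hR_eq]
  exact (hcompact.comp_clm S).codRestrict hSK hclosed
end

section
/- Let H_B be a complex Hilbert space and D_B an unbounded self-adjoint operator on H_B with compact resolvent. On the Hilbert space ℓ²(ℤ, H_B ⊕ H_B) of square-summable two-sided sequences with values in H_B ⊕ H_B, consider the operator D defined on the dense subspace of finitely supported sequences η with η_k ∈ dom(D_B) × dom(D_B) for all k ∈ ℤ by (Dη)_k := (D_B((η_k)_2) − i·k·(η_k)_2, D_B((η_k)_1) + i·k·(η_k)_1). Then D is symmetric and essentially self-adjoint, and its closure is a self-adjoint operator with compact resolvent. -/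
open scoped ENNReal InnerProductSpace

open Filter Topology

namespace LinearPMap

section Symmetric

variable {E : Type*} [NormedAddCommGroup E] [InnerProductSpace ℂ E]

theorem IsFormalAdjoint.norm_sq_apply_add_I_smul {A : E →ₗ.[ℂ] E} (hA : A.IsFormalAdjoint A)
    (x : A.domain) (c : ℝ) :
    ‖A x + (Complex.I * c) • (x : E)‖ ^ 2 = ‖A x‖ ^ 2 + c ^ 2 * ‖(x : E)‖ ^ 2 := by
  have him : (⟪A x, (x : E)⟫_ℂ).im = 0 := by
    rw [← Complex.conj_eq_iff_im, inner_conj_symm, hA]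
  rw [norm_add_sq (𝕜 := ℂ), inner_smul_right, norm_smul]
  simp [mul_assoc, him, mul_pow]

theorem IsFormalAdjoint.closure {A : E →ₗ.[ℂ] E} (hA : A.IsFormalAdjoint A)
    (hcl : A.IsClosable) : A.closure.IsFormalAdjoint A.closure := by
  have hclosed : _root_.IsClosed {p : (E × E) × (E × E) | ⟪p.1.2, p.2.1⟫_ℂ = ⟪p.1.1, p.2.2⟫_ℂ} :=
    isClosed_eq (by fun_prop) (by fun_prop)
  have hsub : (A.graph : Set (E × E)) ×ˢ (A.graph : Set (E × E)) ⊆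
      {p : (E × E) × (E × E) | ⟪p.1.2, p.2.1⟫_ℂ = ⟪p.1.1, p.2.2⟫_ℂ} := by
    rintro ⟨p, q⟩ ⟨hp, hq⟩
    obtain ⟨x, rfl⟩ := A.mem_graph_iff'.1 hp
    obtain ⟨y, rfl⟩ := A.mem_graph_iff'.1 hq
    exact hA x y
  intro x y
  have hx := A.closure.mem_graph x
  have hy := A.closure.mem_graph y
  rw [← hcl.graph_closure_eq_closure_graph] at hx hy
  have hxy := closure_minimal hsub hclosed
  rw [closure_prod_eq] at hxy
  exact hxy (Set.mk_mem_prod hx hy)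

/-- The basic criterion for self-adjointness: a densely defined symmetric operator with both
`±i` in its resolvent set is self-adjoint. -/
theorem IsFormalAdjoint.isSelfAdjoint_of_isResolventAt [CompleteSpace E] {A : E →ₗ.[ℂ] E}
    (hA : A.IsFormalAdjoint A) (hd : Dense (A.domain : Set E)) {R S : E →L[ℂ] E}
    (hR : IsResolventAt A Complex.I R) (hS : IsResolventAt A (-Complex.I) S) :
    IsSelfAdjoint A := by
  have hle : A ≤ A.adjoint := hA.le_adjoint hd
  refine isSelfAdjoint_def.2 (le_antisymm ?_ hle)
  refine ⟨?_, fun x y hxy => (hle.2 hxy.symm).symm⟩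
  intro y hy
  obtain ⟨hx, hxeq⟩ := hR.2 (Complex.I • y - A.adjoint ⟨y, hy⟩)
  set x := R (Complex.I • y - A.adjoint ⟨y, hy⟩)
  obtain ⟨hv, hveq⟩ := hS.2 (y - x)
  set v := S (y - x)
  have h₁ := adjoint_isFormalAdjoint hd ⟨y, hy⟩ ⟨v, hv⟩
  have h₂ := hA ⟨x, hx⟩ ⟨v, hv⟩
  have hyx : A.adjoint ⟨y, hy⟩ - A ⟨x, hx⟩ = Complex.I • (y - x) := by
    linear_combination (norm := module) hxeq
  have h₃ : ⟪Complex.I • (y - x), v⟫_ℂ = ⟪y - x, A ⟨v, hv⟩⟫_ℂ := by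
    rw [← hyx, inner_sub_left, inner_sub_left, h₁, h₂]
  have h₄ : ⟪y - x, -Complex.I • v - A ⟨v, hv⟩⟫_ℂ = 0 := by
    rw [inner_sub_right, ← h₃, inner_smul_right, inner_smul_left, Complex.conj_I, sub_self]
  rw [hveq, inner_self_eq_zero, sub_eq_zero] at h₄
  rw [h₄]
  exact hx

end Symmetric

end LinearPMap

section Resolvent

variable {E : Type*} [NormedAddCommGroup E] [InnerProductSpace ℂ E]

theorem isResolventAt_closure {A : E →ₗ.[ℂ] E} (hcl : A.IsClosable) {z : ℂ} {R : E →L[ℂ] E}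
    {s : Set E} (hs : Dense s) (hleft : ∀ ξ : A.domain, R (z • (ξ : E) - A ξ) = ξ)
    (hright : ∀ η ∈ s, ∃ h : R η ∈ A.domain, z • R η - A ⟨R η, h⟩ = η) :
    IsResolventAt A.closure z R := by
  constructor
  · intro ξ
    have hclosed : IsClosed {p : E × E | R (z • p.1 - p.2) = p.1} :=
      isClosed_eq (by fun_prop) (by fun_prop)
    have hsub : (A.graph : Set (E × E)) ⊆ {p : E × E | R (z • p.1 - p.2) = p.1} := by
      intro p hp
      obtain ⟨x, rfl⟩ := A.mem_graph_iff'.1 hp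
      exact hleft x
    have hξ := A.closure.mem_graph ξ
    rw [← hcl.graph_closure_eq_closure_graph] at hξ
    exact closure_minimal hsub hclosed hξ
  · intro η
    have hclosed : IsClosed {η : E | (R η, z • R η - η) ∈ A.closure.graph} :=
      hcl.closure_isClosed.preimage (by fun_prop)
    have hsub : s ⊆ {η : E | (R η, z • R η - η) ∈ A.closure.graph} := by
      intro η hη
      obtain ⟨h, heq⟩ := hright η hη
      have hval : z • R η - η = A ⟨R η, h⟩ :=
        sub_eq_iff_eq_add.2 ((sub_eq_iff_eq_add.1 heq).trans (add_comm _ _))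
      rw [Set.mem_ofPred_eq, hval]
      exact LinearPMap.le_graph_of_le A.le_closure (A.mem_graph ⟨R η, h⟩)
    have hη : (R η, z • R η - η) ∈ A.closure.graph := by
      have := closure_minimal hsub hclosed
      rw [hs.closure_eq] at this
      exact this (Set.mem_univ η)
    obtain ⟨x, hx, hAx⟩ := A.closure.mem_graph_iff.1 hη
    have hmem : R η ∈ A.closure.domain := by
      rw [← show (x : E) = R η from hx]
      exact x.2
    refine ⟨hmem, ?_⟩
    rw [show (⟨R η, hmem⟩ : A.closure.domain) = x from Subtype.ext hx.symm, hAx]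
    simp

theorem IsResolventAt.norm_le_inv {A : E →ₗ.[ℂ] E} {z : ℂ} {R : E →L[ℂ] E}
    (hR : IsResolventAt A z R) {c : ℝ} (hc : 0 < c)
    (hbound : ∀ x : A.domain, c * ‖(x : E)‖ ≤ ‖z • (x : E) - A x‖) : ‖R‖ ≤ c⁻¹ := by
  refine R.opNorm_le_bound (by positivity) fun y => ?_
  obtain ⟨h, hy⟩ := hR.2 y
  have := hbound ⟨R y, h⟩
  rw [hy] at this
  rwa [inv_mul_eq_div, le_div_iff₀' hc]

/-- If `J` is an injective compact operator inverting `z - A` up to a perturbation `C ∘ J` with `C`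
bounded, and `z - A` is injective, then `z` lies in the resolvent set of `A` and the resolvent is
compact. -/
theorem exists_isResolventAt_of_parametrix [CompleteSpace E] {A : E →ₗ.[ℂ] E} {z : ℂ}
    (hinj : ∀ x : A.domain, z • (x : E) - A x = 0 → (x : E) = 0) {J : E →L[ℂ] E} (C : E →L[ℂ] E)
    (hJ : IsCompactOperator J) (hJinj : ∀ y, J y = 0 → y = 0)
    (hJA : ∀ y, ∃ h : J y ∈ A.domain, z • J y - A ⟨J y, h⟩ = y + C (J y)) :
    ∃ R : E →L[ℂ] E, IsResolventAt A z R ∧ IsCompactOperator R := by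
  have hCJ : IsCompactOperator (C ∘L J) := hJ.clm_comp C
  have hunit : IsUnit (1 + C ∘L J) := by
    rcases hCJ.hasEigenvalue_or_mem_resolventSet (μ := (-1 : ℂ)) (by simp) with h | h
    · obtain ⟨y, hy⟩ := h.exists_hasEigenvector
      have hCy : C (J y) = -y := by simpa using hy.apply_eq_smul
      obtain ⟨hd, hz⟩ := hJA y
      rw [hCy, add_neg_cancel] at hz
      exact absurd (hJinj y (hinj ⟨J y, hd⟩ hz)) hy.2
    · rw [spectrum.mem_resolventSet_iff, ← IsUnit.neg_iff] at h
      convert h using 1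
      simp
      abel
  obtain ⟨u, hu⟩ := hunit
  have hright : ∀ η, ∃ h : (J ∘L (↑u⁻¹ : E →L[ℂ] E)) η ∈ A.domain,
      z • (J ∘L (↑u⁻¹ : E →L[ℂ] E)) η - A ⟨(J ∘L (↑u⁻¹ : E →L[ℂ] E)) η, h⟩ = η := by
    intro η
    obtain ⟨h, heq⟩ := hJA ((↑u⁻¹ : E →L[ℂ] E) η)
    refine ⟨h, heq.trans ?_⟩
    have := congrArg (fun B : E →L[ℂ] E => B η) u.mul_inv
    simpa [hu] using this
  refine ⟨J ∘L (↑u⁻¹ : E →L[ℂ] E), ⟨fun ξ => ?_, hright⟩, hJ.comp_clm _⟩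
  obtain ⟨h, heq⟩ := hright (z • (ξ : E) - A ξ)
  set x := (J ∘L (↑u⁻¹ : E →L[ℂ] E)) (z • (ξ : E) - A ξ)
  have := hinj (⟨x, h⟩ - ξ) (by
    rw [LinearPMap.map_sub, Submodule.coe_sub]
    linear_combination (norm := module) heq)
  simpa [sub_eq_zero] using this

end Resolvent

section DirectSum

variable {ι E : Type*} [NormedAddCommGroup E]

theorem lp.sum_single_apply [DecidableEq ι] (f : ι → E) (s : Finset ι) (k : ι) :
    (∑ i ∈ s, lp.single (E := fun _ : ι => E) 2 i (f i)) k = if k ∈ s then f k else 0 := by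
  rw [lp.coeFn_sum, Finset.sum_apply]
  exact Finset.sum_pi_single k f s

theorem lp.dense_setOf_finite_support :
    Dense {η : lp (fun _ : ι => E) 2 | {k | η k ≠ 0}.Finite} := by
  classical
  intro η
  refine mem_closure_of_tendsto (lp.hasSum_single (by simp) η) (Eventually.of_forall fun s => ?_)
  refine s.finite_toSet.subset fun k hk => ?_
  by_contra hks
  exact hk ((lp.sum_single_apply _ s k).trans (if_neg hks))

variable [InnerProductSpace ℂ E]

theorem lp.isCompactOperator_mapCLM [CompleteSpace E] (R : ι → E →L[ℂ] E) {K : ℝ} (hK : 0 ≤ K)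
    (hRK : ∀ i, ‖R i‖ ≤ K) (hR : ∀ i, IsCompactOperator (R i))
    (hlim : Tendsto (fun i => ‖R i‖) cofinite (𝓝 0)) :
    IsCompactOperator (lp.mapCLM (E := fun _ : ι => E) (F := fun _ : ι => E) 2 R hK hRK) := by
  classical
  let P : Finset ι → (lp (fun _ : ι => E) 2 →L[ℂ] lp (fun _ : ι => E) 2) := fun s =>
    ∑ i ∈ s, lp.singleContinuousLinearMap ℂ (fun _ : ι => E) 2 i ∘L R i ∘L
      lp.evalCLM ℂ (fun _ : ι => E) 2 i
  have hP : ∀ s, IsCompactOperator (P s) := fun s =>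
    Submodule.sum_mem (compactOperator (RingHom.id ℂ) (lp (fun _ : ι => E) 2)
      (lp (fun _ : ι => E) 2)) fun i _ =>
        ((hR i).comp_clm (lp.evalCLM ℂ (fun _ : ι => E) 2 i)).clm_comp
          (lp.singleContinuousLinearMap ℂ (fun _ : ι => E) 2 i)
  refine isCompactOperator_of_tendsto (l := (atTop : Filter (Finset ι))) (F := P) ?_
    (Eventually.of_forall hP)
  rw [Metric.tendsto_atTop]
  intro ε hε
  have hfin : {i | ¬ ‖R i‖ < ε / 2}.Finite := hlim.eventually_lt_const (half_pos hε)
  refine ⟨hfin.toFinset, fun s hs => ?_⟩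
  have hbound : ∀ i, ‖if i ∈ s then 0 else R i‖ ≤ ε / 2 := by
    intro i
    split_ifs with hi
    · simpa using (half_pos hε).le
    · by_contra hcon
      exact hi (hs (hfin.mem_toFinset.2 fun hlt => hcon hlt.le))
  have hdiff : lp.mapCLM (E := fun _ : ι => E) (F := fun _ : ι => E) 2 R hK hRK - P s =
      lp.mapCLM (E := fun _ : ι => E) (F := fun _ : ι => E) 2 (fun i => if i ∈ s then 0 else R i)
        (half_pos hε).le hbound := by
    ext η k
    have hPη : P s η = ∑ i ∈ s, lp.single (E := fun _ : ι => E) 2 i (R i (η i)) := by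
      simp [P, lp.evalCLM]
    change R k (η k) - (P s η) k = (if k ∈ s then 0 else R k) (η k)
    rw [hPη, lp.sum_single_apply]
    split_ifs <;> simp
  rw [dist_comm, dist_eq_norm, hdiff]
  exact (lp.norm_mapCLM_le _ _ _ _).trans_lt (half_lt_self hε)

/-- The algebraic direct sum of the operators `A k`, an operator on the Hilbert sum. -/
structure IsAlgebraicDirectSum (A : ι → E →ₗ.[ℂ] E)
    (D : lp (fun _ : ι => E) 2 →ₗ.[ℂ] lp (fun _ : ι => E) 2) : Prop where
  mem_domain_iff : ∀ η, η ∈ D.domain ↔ {k | η k ≠ 0}.Finite ∧ ∀ k, η k ∈ (A k).domain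
  apply_eq : ∀ (ξ : D.domain) (k : ι) (h : (ξ : lp (fun _ : ι => E) 2) k ∈ (A k).domain),
    (D ξ) k = A k ⟨_, h⟩

namespace IsAlgebraicDirectSum

variable {A : ι → E →ₗ.[ℂ] E} {D : lp (fun _ : ι => E) 2 →ₗ.[ℂ] lp (fun _ : ι => E) 2}

theorem apply_mem (hD : IsAlgebraicDirectSum A D) (ξ : D.domain) (k : ι) :
    (ξ : lp (fun _ : ι => E) 2) k ∈ (A k).domain :=
  ((hD.mem_domain_iff ξ).1 ξ.2).2 k

theorem dense_domain [CompleteSpace E] (hD : IsAlgebraicDirectSum A D)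
    (hA : ∀ k, Dense ((A k).domain : Set E)) :
    Dense (D.domain : Set (lp (fun _ : ι => E) 2)) := by
  classical
  rw [Submodule.dense_iff_topologicalClosure_eq_top, Submodule.topologicalClosure_eq_top_iff,
    Submodule.eq_bot_iff]
  intro y hy
  ext k
  refine (hA k).eq_zero_of_inner_right ℂ fun x hx => ?_
  rw [← lp.inner_single_left k x y]
  refine hy _ ((hD.mem_domain_iff _).2 ⟨(Set.finite_singleton k).subset fun j hj => ?_, fun j => ?_⟩)
  · by_contra hjk
    exact hj (lp.single_apply_ne (E := fun _ : ι => E) 2 k x hjk)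
  · rcases eq_or_ne j k with rfl | hjk
    · rwa [lp.single_apply_self (E := fun _ : ι => E) 2 j x]
    · rw [lp.single_apply_ne (E := fun _ : ι => E) 2 k x hjk]
      exact zero_mem _

theorem isFormalAdjoint (hD : IsAlgebraicDirectSum A D)
    (hA : ∀ k, (A k).IsFormalAdjoint (A k)) : D.IsFormalAdjoint D := by
  intro ξ η
  rw [lp.inner_eq_tsum, lp.inner_eq_tsum]
  refine tsum_congr fun k => ?_
  rw [hD.apply_eq ξ k (hD.apply_mem ξ k), hD.apply_eq η k (hD.apply_mem η k)]
  exact hA k ⟨_, _⟩ ⟨_, _⟩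

theorem isResolventAt_closure (hD : IsAlgebraicDirectSum A D) (hcl : D.IsClosable) {z : ℂ}
    {R : ι → E →L[ℂ] E} {K : ℝ} (hK : 0 ≤ K) (hRK : ∀ i, ‖R i‖ ≤ K)
    (hR : ∀ k, IsResolventAt (A k) z (R k)) :
    IsResolventAt D.closure z
      (lp.mapCLM (E := fun _ : ι => E) (F := fun _ : ι => E) 2 R hK hRK) := by
  refine _root_.isResolventAt_closure hcl lp.dense_setOf_finite_support (fun ξ => ?_)
    fun η hη => ?_
  · ext k
    have := (hR k).1 ⟨_, hD.apply_mem ξ k⟩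
    rw [← hD.apply_eq] at this
    exact this
  · have hmem : lp.mapCLM (E := fun _ : ι => E) (F := fun _ : ι => E) 2 R hK hRK η ∈ D.domain := by
      refine (hD.mem_domain_iff _).2 ⟨hη.subset fun k hk hηk => hk ?_, fun k => ?_⟩
      · simp [hηk]
      · exact ((hR k).2 (η k)).1
    refine ⟨hmem, ?_⟩
    ext k
    obtain ⟨h, heq⟩ := (hR k).2 (η k)
    have := hD.apply_eq ⟨_, hmem⟩ k h
    simp only [lp.coeFn_sub, lp.coeFn_smul, Pi.sub_apply, Pi.smul_apply]
    rw [this]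
    exact heq

end IsAlgebraicDirectSum

end DirectSum

section Fiber

variable {H : Type*} [NormedAddCommGroup H] [InnerProductSpace ℂ H]

/-- The domain `dom T ⊕ dom T` of `diracFiber`. -/
def diracFiberDomain (T : H →ₗ.[ℂ] H) : Submodule ℂ (WithLp 2 (H × H)) :=
  (T.domain.prod T.domain).comap (WithLp.linearEquiv 2 ℂ (H × H)).toLinearMap

theorem fst_mem_of_mem_diracFiberDomain {T : H →ₗ.[ℂ] H} (x : diracFiberDomain T) :
    (x : WithLp 2 (H × H)).fst ∈ T.domain := x.2.1

theorem snd_mem_of_mem_diracFiberDomain {T : H →ₗ.[ℂ] H} (x : diracFiberDomain T) :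
    (x : WithLp 2 (H × H)).snd ∈ T.domain := x.2.2

/-- The operator `T ⊗ σ₁ + κ σ₂` on `H ⊕ H`. -/
noncomputable def diracFiber (T : H →ₗ.[ℂ] H) (κ : ℝ) :
    WithLp 2 (H × H) →ₗ.[ℂ] WithLp 2 (H × H) where
  domain := diracFiberDomain T
  toFun :=
    { toFun x := WithLp.toLp 2
        (T ⟨(x : WithLp 2 (H × H)).snd, snd_mem_of_mem_diracFiberDomain x⟩ -
            (Complex.I * κ) • (x : WithLp 2 (H × H)).snd,
          T ⟨(x : WithLp 2 (H × H)).fst, fst_mem_of_mem_diracFiberDomain x⟩ +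
            (Complex.I * κ) • (x : WithLp 2 (H × H)).fst)
      map_add' x y := by
        have h₁ := T.map_add ⟨_, fst_mem_of_mem_diracFiberDomain x⟩
          ⟨_, fst_mem_of_mem_diracFiberDomain y⟩
        have h₂ := T.map_add ⟨_, snd_mem_of_mem_diracFiberDomain x⟩
          ⟨_, snd_mem_of_mem_diracFiberDomain y⟩
        rw [AddMemClass.mk_add_mk] at h₁ h₂
        simp only [Submodule.coe_add, WithLp.add_fst, WithLp.add_snd, h₁, h₂, smul_add,
          ← WithLp.toLp_add, Prod.mk_add_mk]
        congr 2 <;> abel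
      map_smul' c x := by
        have h₁ := T.map_smul c ⟨_, fst_mem_of_mem_diracFiberDomain x⟩
        have h₂ := T.map_smul c ⟨_, snd_mem_of_mem_diracFiberDomain x⟩
        rw [SetLike.mk_smul_mk] at h₁ h₂
        simp only [Submodule.coe_smul, WithLp.smul_fst, WithLp.smul_snd, h₁, h₂, RingHom.id_apply,
          ← WithLp.toLp_smul, Prod.smul_mk, smul_sub, smul_add, smul_comm c] }

variable {T : H →ₗ.[ℂ] H} {κ : ℝ}

theorem mem_domain_diracFiber {x : WithLp 2 (H × H)} :
    x ∈ (diracFiber T κ).domain ↔ x.fst ∈ T.domain ∧ x.snd ∈ T.domain := Iff.rfl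

theorem diracFiber_apply (x : WithLp 2 (H × H)) (hx : x ∈ (diracFiber T κ).domain)
    (h₁ : x.fst ∈ T.domain) (h₂ : x.snd ∈ T.domain) :
    diracFiber T κ ⟨x, hx⟩ = WithLp.toLp 2
      (T ⟨x.snd, h₂⟩ - (Complex.I * κ) • x.snd, T ⟨x.fst, h₁⟩ + (Complex.I * κ) • x.fst) := rfl

theorem dense_domain_diracFiber (hT : Dense (T.domain : Set H)) :
    Dense ((diracFiber T κ).domain : Set (WithLp 2 (H × H))) :=
  (hT.prod hT).preimage (WithLp.prodContinuousLinearEquiv 2 ℂ H H).toHomeomorph.isOpenMap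

theorem isFormalAdjoint_diracFiber (hT : T.IsFormalAdjoint T) :
    (diracFiber T κ).IsFormalAdjoint (diracFiber T κ) := by
  rintro ⟨x, hx⟩ ⟨y, hy⟩
  obtain ⟨hx₁, hx₂⟩ := mem_domain_diracFiber.1 hx
  obtain ⟨hy₁, hy₂⟩ := mem_domain_diracFiber.1 hy
  have h₁ := hT ⟨_, hx₂⟩ ⟨_, hy₁⟩
  have h₂ := hT ⟨_, hx₁⟩ ⟨_, hy₂⟩
  rw [diracFiber_apply x hx hx₁ hx₂, diracFiber_apply y hy hy₁ hy₂]
  simp only [WithLp.prod_inner_apply, inner_sub_left, inner_add_left,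
    inner_sub_right, inner_add_right, inner_smul_left, inner_smul_right, map_mul, Complex.conj_I,
    Complex.conj_ofReal, WithLp.ofLp_fst, WithLp.ofLp_snd, h₁, h₂]
  ring

theorem norm_sq_diracFiber_apply (hT : T.IsFormalAdjoint T) (x : (diracFiber T κ).domain) :
    κ ^ 2 * ‖(x : WithLp 2 (H × H))‖ ^ 2 ≤ ‖diracFiber T κ x‖ ^ 2 := by
  obtain ⟨x, hx⟩ := x
  obtain ⟨hx₁, hx₂⟩ := mem_domain_diracFiber.1 hx
  have h₁ := hT.norm_sq_apply_add_I_smul ⟨_, hx₁⟩ κ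
  have h₂ := hT.norm_sq_apply_add_I_smul ⟨_, hx₂⟩ (-κ)
  rw [Complex.ofReal_neg, mul_neg, neg_smul, ← sub_eq_add_neg] at h₂
  rw [WithLp.prod_norm_sq_eq_of_L2, WithLp.prod_norm_sq_eq_of_L2, diracFiber_apply x hx hx₁ hx₂]
  change _ ≤ ‖T ⟨_, hx₂⟩ - (Complex.I * κ) • x.snd‖ ^ 2 + ‖T ⟨_, hx₁⟩ + (Complex.I * κ) • x.fst‖ ^ 2
  rw [h₁, h₂]
  nlinarith [sq_nonneg ‖T ⟨_, hx₁⟩‖, sq_nonneg ‖T ⟨_, hx₂⟩‖]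

theorem norm_sq_smul_sub_diracFiber (hT : T.IsFormalAdjoint T) {c : ℝ} (hc : c ^ 2 = 1)
    (x : (diracFiber T κ).domain) :
    (1 + κ ^ 2) * ‖(x : WithLp 2 (H × H))‖ ^ 2 ≤
      ‖(Complex.I * c) • (x : WithLp 2 (H × H)) - diracFiber T κ x‖ ^ 2 := by
  have h := (isFormalAdjoint_diracFiber (κ := κ) hT).norm_sq_apply_add_I_smul x (-c)
  rw [Complex.ofReal_neg, mul_neg, neg_smul, ← sub_eq_add_neg, neg_sq, hc] at h
  rw [norm_sub_rev, h]
  linarith [norm_sq_diracFiber_apply hT x]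

theorem exists_isResolventAt_diracFiber [CompleteSpace H] (hT : T.IsFormalAdjoint T)
    (hcr : HasCompactResolvent T) (κ : ℝ) {c : ℝ} (hc : c ^ 2 = 1) :
    ∃ R : WithLp 2 (H × H) →L[ℂ] WithLp 2 (H × H),
      IsResolventAt (diracFiber T κ) (Complex.I * c) R ∧ IsCompactOperator R := by
  obtain ⟨lam, R, hR, hcomp⟩ := hcr
  let e := (WithLp.prodContinuousLinearEquiv 2 ℂ H H).symm.toContinuousLinearMap
  let p := WithLp.fstL 2 ℂ H H
  let q := WithLp.sndL 2 ℂ H H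
  let a := e ∘L ContinuousLinearMap.inl ℂ H H
  let b := e ∘L ContinuousLinearMap.inr ℂ H H
  have hRinj : ∀ y, R y = 0 → y = 0 := by
    intro y hy
    obtain ⟨h, heq⟩ := hR.2 y
    have hz : T ⟨R y, h⟩ = 0 := by
      rw [show (⟨R y, h⟩ : T.domain) = 0 from Subtype.ext hy, LinearPMap.map_zero]
    rw [← heq, hz, hy, smul_zero, sub_zero]
  refine exists_isResolventAt_of_parametrix (J := a ∘L R ∘L q + b ∘L R ∘L p) ?_
    (a ∘L ((Complex.I * c) • p + (Complex.I * κ - lam) • q) +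
      b ∘L ((Complex.I * c) • q + (-(Complex.I * κ) - lam) • p))
    (((hcomp.comp_clm q).clm_comp a).add ((hcomp.comp_clm p).clm_comp b)) ?_ ?_
  · intro x hx
    have h := norm_sq_smul_sub_diracFiber hT hc x
    rw [hx, norm_zero] at h
    have : ‖(x : WithLp 2 (H × H))‖ ^ 2 = 0 := by
      nlinarith [sq_nonneg ‖(x : WithLp 2 (H × H))‖, sq_nonneg κ,
        mul_nonneg (sq_nonneg κ) (sq_nonneg ‖(x : WithLp 2 (H × H))‖)]
    simpa using this
  · intro y hy
    have h₁ : R y.snd = 0 := by simpa [a, b, e, p, q] using congrArg WithLp.fst hy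
    have h₂ : R y.fst = 0 := by simpa [a, b, e, p, q] using congrArg WithLp.snd hy
    exact WithLp.ofLp_injective 2 (Prod.ext (hRinj _ h₂) (hRinj _ h₁))
  · intro y
    obtain ⟨h₁, heq₁⟩ := hR.2 y.fst
    obtain ⟨h₂, heq₂⟩ := hR.2 y.snd
    have hJ : (a ∘L R ∘L q + b ∘L R ∘L p) y = WithLp.toLp 2 (R y.snd, R y.fst) := by
      refine WithLp.ofLp_injective 2 (Prod.ext ?_ ?_) <;> simp [a, b, e, p, q]
    rw [hJ]
    have hmem : WithLp.toLp 2 (R y.snd, R y.fst) ∈ (diracFiber T κ).domain :=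
      mem_domain_diracFiber.2 ⟨h₂, h₁⟩
    refine ⟨hmem, ?_⟩
    rw [diracFiber_apply _ hmem h₂ h₁]
    refine WithLp.ofLp_injective 2 (Prod.ext ?_ ?_)
    · simp [a, b, e, p, q]
      linear_combination (norm := module) heq₁
    · simp [a, b, e, p, q]
      linear_combination (norm := module) heq₂

theorem IsResolventAt.norm_le_one_of_diracFiber (hT : T.IsFormalAdjoint T) {c : ℝ}
    (hc : c ^ 2 = 1) {R : WithLp 2 (H × H) →L[ℂ] WithLp 2 (H × H)}
    (hR : IsResolventAt (diracFiber T κ) (Complex.I * c) R) : ‖R‖ ≤ 1 := by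
  refine (hR.norm_le_inv one_pos fun x => ?_).trans_eq inv_one
  refine (sq_le_sq₀ (by positivity) (by positivity)).1 ?_
  nlinarith [norm_sq_smul_sub_diracFiber hT hc x,
    mul_nonneg (sq_nonneg κ) (sq_nonneg ‖(x : WithLp 2 (H × H))‖)]

theorem IsResolventAt.norm_le_inv_abs_of_diracFiber (hT : T.IsFormalAdjoint T) (hκ : κ ≠ 0)
    {c : ℝ} (hc : c ^ 2 = 1) {R : WithLp 2 (H × H) →L[ℂ] WithLp 2 (H × H)}
    (hR : IsResolventAt (diracFiber T κ) (Complex.I * c) R) : ‖R‖ ≤ |κ|⁻¹ := by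
  refine hR.norm_le_inv (abs_pos.2 hκ) fun x => ?_
  refine (sq_le_sq₀ (by positivity) (by positivity)).1 ?_
  rw [mul_pow, sq_abs]
  nlinarith [norm_sq_smul_sub_diracFiber hT hc x, sq_nonneg ‖(x : WithLp 2 (H × H))‖]

theorem tendsto_norm_of_isResolventAt_diracFiber (hT : T.IsFormalAdjoint T) {c : ℝ}
    (hc : c ^ 2 = 1) {R : ℤ → WithLp 2 (H × H) →L[ℂ] WithLp 2 (H × H)}
    (hR : ∀ k : ℤ, IsResolventAt (diracFiber T k) (Complex.I * c) (R k)) :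
    Tendsto (fun k => ‖R k‖) cofinite (𝓝 0) := by
  refine squeeze_zero' (Eventually.of_forall fun k => norm_nonneg (R k)) ?_
    (tendsto_inv_atTop_zero.comp
      ((tendsto_norm_cocompact_atTop (E := ℝ)).comp Int.tendsto_coe_cofinite))
  filter_upwards [(Set.finite_singleton (0 : ℤ)).eventually_cofinite_notMem] with k hk
  exact (hR k).norm_le_inv_abs_of_diracFiber hT (Int.cast_ne_zero.2 hk) hc

end Fiber

/-- Let `T = D_B` be an unbounded self-adjoint operator with compact resolvent
on a complex Hilbert space `H`. On `ℓ²(ℤ, H ⊕ H)` the operator `D`, defined on the finitely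
supported sequences valued in `dom T × dom T` by
`(D η)_k = (T ((η_k)_2) − i k (η_k)_2, T ((η_k)_1) + i k (η_k)_1)`,
is symmetric and essentially self-adjoint, and its closure is self-adjoint with compact
resolvent. -/
theorem statement12 {H : Type*} [NormedAddCommGroup H] [InnerProductSpace ℂ H] [CompleteSpace H]
    (T : H →ₗ.[ℂ] H) (hsaT : IsSelfAdjoint T) (hcr : HasCompactResolvent T)
    (D : (lp (fun _ : ℤ => WithLp 2 (H × H)) 2) →ₗ.[ℂ] (lp (fun _ : ℤ => WithLp 2 (H × H)) 2))
    (hD_dom : ∀ η : lp (fun _ : ℤ => WithLp 2 (H × H)) 2,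
      η ∈ D.domain ↔
        (Set.Finite {k : ℤ | η k ≠ 0} ∧
          ∀ k : ℤ, (WithLp.equiv 2 (H × H) (η k)).1 ∈ T.domain ∧
            (WithLp.equiv 2 (H × H) (η k)).2 ∈ T.domain))
    (hD : ∀ (ξ : D.domain) (k : ℤ)
        (h₁ : (WithLp.equiv 2 (H × H) ((ξ : lp (fun _ : ℤ => WithLp 2 (H × H)) 2) k)).1 ∈ T.domain)
        (h₂ : (WithLp.equiv 2 (H × H) ((ξ : lp (fun _ : ℤ => WithLp 2 (H × H)) 2) k)).2 ∈ T.domain),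
      WithLp.equiv 2 (H × H) ((D ξ) k) =
        (T ⟨_, h₂⟩ - (Complex.I * (k : ℂ)) •
            (WithLp.equiv 2 (H × H) ((ξ : lp (fun _ : ℤ => WithLp 2 (H × H)) 2) k)).2,
         T ⟨_, h₁⟩ + (Complex.I * (k : ℂ)) •
            (WithLp.equiv 2 (H × H) ((ξ : lp (fun _ : ℤ => WithLp 2 (H × H)) 2) k)).1)) :
    Dense (D.domain : Set (lp (fun _ : ℤ => WithLp 2 (H × H)) 2)) ∧
    (∀ ξ η : D.domain,
      ⟪(D ξ : lp (fun _ : ℤ => WithLp 2 (H × H)) 2), (η : lp (fun _ : ℤ => WithLp 2 (H × H)) 2)⟫_ℂ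
        = ⟪((ξ : lp (fun _ : ℤ => WithLp 2 (H × H)) 2)), (D η : lp (fun _ : ℤ => WithLp 2 (H × H)) 2)⟫_ℂ) ∧
    D.IsClosable ∧
    IsSelfAdjoint D.closure ∧
    HasCompactResolvent D.closure := by
  have hdT := hsaT.dense_domain
  have hT : T.IsFormalAdjoint T := by
    have h := LinearPMap.adjoint_isFormalAdjoint hdT
    rwa [LinearPMap.isSelfAdjoint_def.1 hsaT] at h
  have hsum : IsAlgebraicDirectSum (fun k : ℤ => diracFiber T k) D := by
    refine ⟨hD_dom, fun ξ k h => ?_⟩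
    obtain ⟨h₁, h₂⟩ := mem_domain_diracFiber.1 h
    refine (WithLp.equiv 2 (H × H)).injective ?_
    rw [hD ξ k h₁ h₂, diracFiber_apply _ h h₁ h₂, Complex.ofReal_intCast]
    rfl
  have hdense := hsum.dense_domain fun k => dense_domain_diracFiber hdT
  have hsymm := hsum.isFormalAdjoint fun k => isFormalAdjoint_diracFiber hT
  have hcl : D.IsClosable :=
    (LinearPMap.adjoint_isClosed hdense).isClosable.leIsClosable (hsymm.le_adjoint hdense)
  have hres : ∀ c : ℝ, c ^ 2 = 1 → ∃ R, IsResolventAt D.closure (Complex.I * c) R ∧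
      IsCompactOperator R := by
    intro c hc
    choose R hR hRc using fun k : ℤ => exists_isResolventAt_diracFiber hT hcr k hc
    have hR1 : ∀ k, ‖R k‖ ≤ 1 := fun k => (hR k).norm_le_one_of_diracFiber hT hc
    exact ⟨_, hsum.isResolventAt_closure hcl zero_le_one hR1 hR,
      lp.isCompactOperator_mapCLM R zero_le_one hR1 hRc
        (tendsto_norm_of_isResolventAt_diracFiber hT hc hR)⟩
  obtain ⟨R, hR, hRc⟩ := hres 1 (by norm_num)
  obtain ⟨S, hS, -⟩ := hres (-1) (by norm_num)
  refine ⟨hdense, hsymm, hcl, ?_, _, R, hR, hRc⟩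
  exact (hsymm.closure hcl).isSelfAdjoint_of_isResolventAt (hdense.mono D.le_closure.1)
    (by simpa using hR) (by simpa using hS)
end
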